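/- arXiv:1205.2824 — 2 statements merged into one kernel-verified Lean document; each statement's English description precedes it below -/
import Mathlib

section
/- Let G be a finite group and h ∈ G a fixed element. The number of pairs (x, y) ∈ G² such that x²y² is conjugate to h is divisible by |G|. -/
theorem aux_dvd {A X : Type*} [Group A] [Finite A] [Finite X] [MulAction A X]
    (R : X → X → Prop) (hR : ∀ (g : A) a b, R a b → R (g • a) (g • b)) :
    Nat.card A ∣ Nat.card {p : X × A // R p.1 (p.2 • p.1)} := by
  classical
  have := Fintype.ofFinite A
  have := Fintype.ofFinite X
  let f : X → ℕ := fun a => Nat.card {g : A // R a (g • a)}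
  have hN : Nat.card {p : X × A // R p.1 (p.2 • p.1)} = ∑ a, f a := by
    rw [← Nat.card_sigma]
    exact Nat.card_congr
      ⟨fun p => ⟨p.1.1, p.1.2, p.2⟩, fun p => ⟨(p.1, p.2.1), p.2.2⟩, fun _ => rfl, fun _ => rfl⟩
  have hf1 : ∀ (g : A) (a : X), f (g • a) = f a := by
    intro g a
    refine (Nat.card_congr (Equiv.subtypeEquiv (MulAut.conj g).toEquiv ?_)).symm
    intro k
    have e : (MulAut.conj g).toEquiv k • g • a = g • k • a := by
      simp [mul_smul]
    rw [e]
    refine ⟨hR g _ _, fun H => ?_⟩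
    simpa using hR g⁻¹ _ _ H
  have hf2 : ∀ a : X, Nat.card (MulAction.stabilizer A a) ∣ f a := by
    intro a
    let t : Set (A ⧸ MulAction.stabilizer A a) :=
      {q | R a (MulAction.ofQuotientStabilizer A a q)}
    have := Nat.card_congr (QuotientGroup.preimageMkEquivSubgroupProdSet _ t)
    rw [Nat.card_prod] at this
    exact ⟨_, this⟩
  rw [hN, ← Finset.sum_fiberwise (s := Finset.univ)
    (g := fun a : X => (Quotient.mk (MulAction.orbitRel A X) a))]
  refine Finset.dvd_sum fun c _ => ?_
  induction c using Quotient.inductionOn with | _ r => ?_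
  rw [Finset.sum_congr rfl (g := fun _ => f r), Finset.sum_const, smul_eq_mul]
  · have h1 : (Finset.univ.filter fun a : X => (Quotient.mk (MulAction.orbitRel A X) a) =
        Quotient.mk _ r).card = Nat.card (MulAction.orbit A r) := by
      rw [← Fintype.card_subtype, ← Nat.card_eq_fintype_card]
      refine Nat.card_congr (Equiv.subtypeEquivRight fun a => ?_)
      rw [Quotient.eq]
      rfl
    rw [h1, ← Nat.card_congr (MulAction.orbitProdStabilizerEquivGroup A r), Nat.card_prod]
    exact Nat.mul_dvd_mul_left _ (hf2 r)
  · intro a ha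
    rw [Finset.mem_filter, Quotient.eq] at ha
    obtain ⟨g, rfl⟩ := ha.2
    exact hf1 g r

theorem stmt_10 (G : Type*) [Group G] [Fintype G] (h : G) :
    Nat.card G ∣ Nat.card {p : G × G // ∃ q : G, p.1 ^ 2 * p.2 ^ 2 = q⁻¹ * h * q} := by
  have : Finite (ConjAct G) := ‹Fintype G›.finite
  have key := aux_dvd (A := ConjAct G) (X := G) (fun a b => ∃ q : G, a * b = q⁻¹ * h * q) (by
    rintro g a b ⟨q, hq⟩
    refine ⟨q * (ConjAct.ofConjAct g)⁻¹, ?_⟩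
    rw [← smul_mul', hq, ConjAct.smul_def]
    group)
  have e1 : Nat.card (ConjAct G) = Nat.card G := Nat.card_congr ConjAct.ofConjAct.toEquiv
  rw [e1] at key
  convert key using 1
  -- substitute `a = x y`, `g = y⁻¹`
  let e : G × G ≃ G × ConjAct G :=
    { toFun := fun p => (p.1 * p.2, ConjAct.toConjAct p.2⁻¹)
      invFun := fun p => (p.1 * ConjAct.ofConjAct p.2, (ConjAct.ofConjAct p.2)⁻¹)
      left_inv := fun p => by simp
      right_inv := fun p => by simp }
  refine Nat.card_congr (Equiv.subtypeEquiv e fun p => ?_)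
  have : (e p).1 * (e p).2 • (e p).1 = p.1 ^ 2 * p.2 ^ 2 := by
    simp [e, ConjAct.smul_def, pow_two, mul_assoc]
  rw [this]
end

section
/- Let G be a finite group. The number of solutions x ∈ G to a system of equations {x^{n_i} g_i x^{m_i} h_i = 1} with one unknown is divisible by gcd(|C|, n₁+m₁, n₂+m₂, ...), where C is the centralizer of the set of coefficients — in the special case of a single equation x^n = g with g central: the number of solutions is divisible by gcd(n, |G|) when g lies in the center of G. -/
theorem aux_exists_hom {p : ℕ} [hp : Fact p.Prime] {N : Type*} [Group N] [Finite N] {m b : ℕ}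
    (hN : Nat.card N = p ^ (m + 1)) (σ : N →* N) (hσ : ∀ u, σ^[p ^ b] u = u) :
    ∃ φ : N →* Multiplicative (ZMod p), φ ≠ 1 ∧ ∀ u, φ (σ u) = φ u := by
  classical
  obtain ⟨K, hK⟩ := Sylow.exists_subgroup_card_pow_prime (G := N) p (n := m)
    (by rw [hN]; exact pow_dvd_pow p (Nat.le_succ m))
  have hidx : K.index = p := by
    have h := K.card_mul_index
    rw [hK, hN, pow_succ] at h
    exact Nat.eq_of_mul_eq_mul_left (pow_pos hp.out.pos m) h
  have hnorm : K.Normal := by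
    apply Subgroup.normal_of_index_eq_minFac_card
    rw [hidx, hN, hp.out.pow_minFac (Nat.succ_ne_zero m)]
  have hq : Nat.card (N ⧸ K) = p := hidx
  have hz : Nat.card (Multiplicative (ZMod p)) = p := by
    simp
  let e : (N ⧸ K) ≃* Multiplicative (ZMod p) := mulEquivOfPrimeCardEq hq hz
  let φ : N →* Multiplicative (ZMod p) := e.toMonoidHom.comp (QuotientGroup.mk' K)
  have hφ : φ ≠ 1 := by
    intro h
    have hK' : K = ⊤ := by
      rw [eq_top_iff]
      intro u _
      have := DFunLike.congr_fun h u
      simp only [φ, MonoidHom.comp_apply, MonoidHom.one_apply] at this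
      have h2 : (QuotientGroup.mk' K u) = 1 := by
        apply e.injective
        rw [map_one]; exact this
      exact (QuotientGroup.eq_one_iff u).1 h2
    rw [hK', Subgroup.index_top] at hidx
    exact hp.out.one_lt.ne hidx
  have : Finite (N →* Multiplicative (ZMod p)) := DFunLike.finite _
  have : Fintype (N →* Multiplicative (ZMod p)) := Fintype.ofFinite _
  have hpow : ∀ z : Multiplicative (ZMod p), z ^ p = 1 := by
    intro z
    have := pow_card_eq_one' (x := z)
    rwa [hz] at this
  have hord : orderOf φ = p := by
    apply orderOf_eq_prime _ hφ
    ext u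
    simp [hpow]
  have hdvd : p ∣ Fintype.card (N →* Multiplicative (ZMod p)) := by
    rw [← Nat.card_eq_fintype_card]
    conv_lhs => rw [← hord]
    exact orderOf_dvd_natCard φ
  let T : Function.End (N →* Multiplicative (ZMod p)) := fun ψ => ψ.comp σ
  have hT : ∀ (i : ℕ) ψ u, (T ^ i) ψ u = ψ (σ^[i] u) := by
    intro i
    induction i with
    | zero => intro ψ u; rfl
    | succ i ih =>
      intro ψ u
      rw [pow_succ]
      change (T ^ i) (T ψ) u = _
      rw [ih, Function.iterate_succ_apply']
      rfl
  have hT1 : T ^ p ^ b = 1 := by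
    funext ψ
    ext u
    rw [hT, hσ]; rfl
  have hfix := Equiv.Perm.card_fixedPoints_modEq hT1
  have hfd : p ∣ Fintype.card (Function.fixedPoints T) :=
    (Nat.modEq_zero_iff_dvd).1 (hfix.symm.trans ((Nat.modEq_zero_iff_dvd).2 hdvd))
  have h1 : (1 : N →* Multiplicative (ZMod p)) ∈ Function.fixedPoints T := by
    change T 1 = 1
    ext u; rfl
  have hpos : 0 < Fintype.card (Function.fixedPoints T) := Fintype.card_pos_iff.2 ⟨⟨1, h1⟩⟩
  have hgt : 1 < Fintype.card (Function.fixedPoints T) :=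
    lt_of_lt_of_le hp.out.one_lt (Nat.le_of_dvd hpos hfd)
  obtain ⟨⟨ψ, hψ⟩, hne⟩ := Fintype.exists_ne_of_one_lt_card hgt ⟨1, h1⟩
  refine ⟨ψ, fun h => hne (Subtype.ext h), fun u => ?_⟩
  exact DFunLike.congr_fun (show T ψ = ψ from hψ) u

theorem aux_pow {p : ℕ} [hp : Fact p.Prime] {G : Type*} [Group G] [Finite G] (b : ℕ) :
    ∀ (x : G) (N : Subgroup G), (∀ h ∈ N, x⁻¹ * h * x ∈ N) →
      (∀ h ∈ N, x ^ p ^ b * h = h * x ^ p ^ b) → Nat.card N ∣ p ^ b →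
      ∀ u ∈ N, (x * u) ^ p ^ b = x ^ p ^ b := by
  induction b with
  | zero =>
    intro x N _ _ hc u hu
    have h1 : Nat.card N = 1 := by simpa using hc
    have : N = ⊥ := Subgroup.card_eq_one.1 h1
    rw [this, Subgroup.mem_bot] at hu
    simp [hu]
  | succ b ih =>
    intro x N hx hcomm hc u hu
    obtain ⟨m, hm, hcard⟩ := (Nat.dvd_prime_pow hp.out).1 hc
    cases m with
    | zero =>
      have : N = ⊥ := Subgroup.card_eq_one.1 (by simpa using hcard)
      rw [this, Subgroup.mem_bot] at hu
      simp [hu]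
    | succ m =>
      let σ : N →* N :=
        { toFun := fun h => ⟨x⁻¹ * h * x, hx h h.2⟩
          map_one' := by ext; simp
          map_mul' := by intro a c; ext; simp [mul_assoc] }
      have hσi : ∀ (i : ℕ) (h : N), ((σ^[i] h : N) : G) = (x ^ i)⁻¹ * h * x ^ i := by
        intro i
        induction i with
        | zero => intro h; simp
        | succ i ihi =>
          intro h
          rw [Function.iterate_succ_apply, ihi]
          change (x ^ i)⁻¹ * (x⁻¹ * h * x) * x ^ i = _
          rw [pow_succ']; group
      obtain ⟨φ, hφ1, hφ⟩ := aux_exists_hom hcard σ (b := b + 1) (by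
        intro h
        ext
        rw [hσi, mul_assoc, ← hcomm h h.2, inv_mul_cancel_left])
      have key : ∀ i : ℕ, ∃ v : N, (x * u) ^ i = x ^ i * v ∧ φ v = φ ⟨u, hu⟩ ^ i := by
        intro i
        induction i with
        | zero => exact ⟨1, by simp, by simp⟩
        | succ i ihi =>
          obtain ⟨v, hv, hv2⟩ := ihi
          refine ⟨σ v * ⟨u, hu⟩, ?_, ?_⟩
          · rw [pow_succ, hv]
            change _ = x ^ (i + 1) * (x⁻¹ * v * x * u)
            rw [pow_succ]; group
          · rw [map_mul, hφ, hv2, pow_succ]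
      obtain ⟨v, hv, hv2⟩ := key p
      have hv1 : φ v = 1 := by
        rw [hv2]
        have := pow_card_eq_one' (x := φ ⟨u, hu⟩)
        simpa using this
      have hφσ : ∀ (i : ℕ) (h : N), φ (σ^[i] h) = φ h := by
        intro i
        induction i with
        | zero => intro h; rfl
        | succ i ihi => intro h; rw [Function.iterate_succ_apply, ihi, hφ]
      have hfin := ih (x ^ p) (φ.ker.map N.subtype) (by
          rintro _ ⟨h, hh, rfl⟩
          refine ⟨σ^[p] h, ?_, ?_⟩
          · change φ _ = 1
            rw [hφσ]; exact hh
          · exact hσi p h) (by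
          rintro _ ⟨h, hh, rfl⟩
          rw [← pow_mul, ← pow_succ']
          exact hcomm h h.2) (by
          rw [Subgroup.card_map_of_injective N.subtype_injective]
          obtain ⟨c, hc1, hc2⟩ := (Nat.dvd_prime_pow hp.out).1
            ((Subgroup.card_subgroup_dvd_card φ.ker).trans hc)
          rw [hc2]
          apply pow_dvd_pow
          by_contra hlt
          apply hφ1
          have : φ.ker = ⊤ := by
            apply Subgroup.eq_top_of_le_card
            rw [hc2, hcard]
            exact Nat.pow_le_pow_right hp.out.pos (by omega)
          ext1 h
          have h3 : h ∈ φ.ker := by rw [this]; trivial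
          exact h3) v ⟨v, hv1, rfl⟩
      rw [pow_succ', pow_mul, hv, hfin, pow_mul]

/-- The elements of `H` all of whose conjugates by powers of `x` stay in `H`. -/
def auxCore {G : Type*} [Group G] (H : Subgroup G) (x : G) : Subgroup G where
  carrier := {h | ∀ i : ℕ, (x ^ i)⁻¹ * h * x ^ i ∈ H}
  one_mem' := by intro i; simp
  mul_mem' := by
    intro a c ha hc i
    have := H.mul_mem (ha i) (hc i)
    have e : (x ^ i)⁻¹ * a * x ^ i * ((x ^ i)⁻¹ * c * x ^ i) = (x ^ i)⁻¹ * (a * c) * x ^ i := by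
      group
    rwa [e] at this
  inv_mem' := by
    intro a ha i
    have := H.inv_mem (ha i)
    have e : ((x ^ i)⁻¹ * a * x ^ i)⁻¹ = (x ^ i)⁻¹ * a⁻¹ * x ^ i := by group
    rwa [e] at this

theorem auxCore_le {G : Type*} [Group G] (H : Subgroup G) (x : G) : auxCore H x ≤ H := by
  intro h hh
  simpa using hh 0

theorem auxCore_conj {G : Type*} [Group G] (H : Subgroup G) (x : G) :
    ∀ h ∈ auxCore H x, x⁻¹ * h * x ∈ auxCore H x := by
  intro h hh i
  have := hh (i + 1)
  rw [pow_succ'] at this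
  have e : (x * x ^ i)⁻¹ * h * (x * x ^ i) = (x ^ i)⁻¹ * (x⁻¹ * h * x) * x ^ i := by group
  rwa [e] at this

/-- A set stable under conjugation by `x` and contained in `H` lies in the core. -/
theorem auxCore_of_stable {G : Type*} [Group G] (H : Subgroup G) (x : G) (S : Set G)
    (hS : S ⊆ H) (hx : ∀ h ∈ S, x⁻¹ * h * x ∈ S) : S ⊆ auxCore H x := by
  intro h hh i
  apply hS
  induction i with
  | zero => simpa using hh
  | succ i ih =>
    have := hx _ ih
    have e : x⁻¹ * ((x ^ i)⁻¹ * h * x ^ i) * x = (x ^ (i + 1))⁻¹ * h * x ^ (i + 1) := by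
      rw [pow_succ]; group
    rwa [e] at this

theorem auxCore_mul_le {G : Type*} [Group G] (H : Subgroup G) (x u : G) (hu : u ∈ auxCore H x) :
    auxCore H x ≤ auxCore H (x * u) := by
  apply auxCore_of_stable H (x * u) (auxCore H x) (auxCore_le H x)
  intro h hh
  have := mul_mem (mul_mem (inv_mem hu) (auxCore_conj H x h hh)) hu
  have e : u⁻¹ * (x⁻¹ * h * x) * u = (x * u)⁻¹ * h * (x * u) := by group
  rw [e] at this
  exact this

theorem auxCore_mul {G : Type*} [Group G] (H : Subgroup G) (x u : G) (hu : u ∈ auxCore H x) :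
    auxCore H (x * u) = auxCore H x := by
  apply le_antisymm _ (auxCore_mul_le H x u hu)
  have := auxCore_mul_le H (x * u) u⁻¹ (inv_mem (auxCore_mul_le H x u hu hu))
  rwa [mul_inv_cancel_right] at this

theorem auxCore_conj_mem {G : Type*} [Group G] (H : Subgroup G) (x h : G) (hh : h ∈ H) (u : G)
    (hu : u ∈ auxCore H x) : h * u * h⁻¹ ∈ auxCore H (h * x * h⁻¹) := by
  intro i
  have := H.mul_mem (H.mul_mem hh (hu i)) (H.inv_mem hh)
  rw [conj_pow]
  have e : h * ((x ^ i)⁻¹ * u * x ^ i) * h⁻¹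
      = (h * x ^ i * h⁻¹)⁻¹ * (h * u * h⁻¹) * (h * x ^ i * h⁻¹) := by group
  rwa [e] at this

/-- `x ~ y` iff `y` is an `H`-conjugate of an element of the coset `x * auxCore H x`. -/
def auxSetoid {G : Type*} [Group G] (H : Subgroup G) : Setoid G where
  r x y := ∃ h ∈ H, ∃ u ∈ auxCore H x, y = h * (x * u) * h⁻¹
  iseqv :=
    { refl := fun x => ⟨1, one_mem _, 1, one_mem _, by simp⟩
      symm := by
        rintro x _ ⟨h, hh, u, hu, rfl⟩
        refine ⟨h⁻¹, inv_mem hh, h * u⁻¹ * h⁻¹, ?_, by group⟩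
        apply auxCore_conj_mem H _ h hh
        rw [auxCore_mul H x u hu]
        exact inv_mem hu
      trans := by
        rintro x _ _ ⟨h, hh, u, hu, rfl⟩ ⟨k, hk, v, hv, rfl⟩
        refine ⟨k * h, mul_mem hk hh, u * (h⁻¹ * v * h), mul_mem hu ?_, by group⟩
        have := auxCore_conj_mem H _ h⁻¹ (inv_mem hh) v hv
        have e : h⁻¹ * (h * (x * u) * h⁻¹) * h⁻¹⁻¹ = x * u := by group
        rw [e, auxCore_mul H x u hu, inv_inv] at this
        exact this }

theorem auxClass_card {G : Type*} [Group G] [Finite G] (H : Subgroup G) (x : G) :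
    Nat.card {y : G // (auxSetoid H).r x y} = Nat.card H := by
  set K : Subgroup H := (auxCore H x).subgroupOf H with hK
  rw [Subgroup.card_eq_card_quotient_mul_card_subgroup K, ← Nat.card_prod]
  symm
  have hout : ∀ t : H ⧸ K, ((t.out : H) : H ⧸ K) = t := fun t => Quotient.out_eq' t
  let f : (H ⧸ K) × K → {y : G // (auxSetoid H).r x y} := fun t =>
    ⟨(t.1.out : G) * (x * ((t.2 : H) : G)) * (t.1.out : G)⁻¹,
      ⟨_, t.1.out.2, _, Subgroup.mem_subgroupOf.1 t.2.2, rfl⟩⟩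
  apply Nat.card_congr (Equiv.ofBijective f ⟨?_, ?_⟩)
  · rintro ⟨t, w⟩ ⟨s, v⟩ heq
    have h1 : (t.out : G) * (x * ((w : H) : G)) * (t.out : G)⁻¹
        = (s.out : G) * (x * ((v : H) : G)) * (s.out : G)⁻¹ := congrArg Subtype.val heq
    have hw : ((w : H) : G) ∈ auxCore H x := Subgroup.mem_subgroupOf.1 w.2
    have hv : ((v : H) : G) ∈ auxCore H x := Subgroup.mem_subgroupOf.1 v.2
    generalize hk : (s.out : G)⁻¹ * (t.out : G) = k
    have h2 : x⁻¹ * k * x = ((v : H) : G) * k * ((w : H) : G)⁻¹ := by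
      have ht : (t.out : G) = (s.out : G) * k := by rw [← hk]; group
      rw [ht] at h1
      have h3 : k * (x * ((w : H) : G)) * k⁻¹ = x * ((v : H) : G) := by
        have := congrArg (fun z => (s.out : G)⁻¹ * z * (s.out : G)) h1
        convert this using 1 <;> group
      have h4 : ((v : H) : G) = x⁻¹ * (k * (x * ((w : H) : G)) * k⁻¹) := by rw [h3]; group
      rw [h4]; group
    have hkH : k ∈ H := by rw [← hk]; exact mul_mem (inv_mem s.out.2) t.out.2
    have hkc : k ∈ auxCore H x := by
      apply auxCore_of_stable H x {z | ∃ a ∈ auxCore H x, ∃ c ∈ auxCore H x, z = a * k * c}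
      · rintro _ ⟨a, ha, c, hc, rfl⟩
        exact mul_mem (mul_mem (auxCore_le H x ha) hkH) (auxCore_le H x hc)
      · rintro _ ⟨a, ha, c, hc, rfl⟩
        refine ⟨x⁻¹ * a * x * ((v : H) : G), mul_mem (auxCore_conj H x a ha) hv,
          ((w : H) : G)⁻¹ * (x⁻¹ * c * x), mul_mem (inv_mem hw) (auxCore_conj H x c hc), ?_⟩
        calc x⁻¹ * (a * k * c) * x = (x⁻¹ * a * x) * (x⁻¹ * k * x) * (x⁻¹ * c * x) := by group
          _ = _ := by rw [h2]; group
      · exact ⟨1, one_mem _, 1, one_mem _, by simp⟩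
    have hts : t = s := by
      rw [← hout t, ← hout s]
      symm
      rw [QuotientGroup.eq, Subgroup.mem_subgroupOf]
      change (s.out : G)⁻¹ * (t.out : G) ∈ _
      rw [hk]; exact hkc
    subst hts
    have h5 : ((w : H) : G) = ((v : H) : G) := by
      simpa using h1
    rw [Prod.mk.injEq]
    exact ⟨rfl, Subtype.ext (Subtype.ext h5)⟩
  · rintro ⟨_, h, hh, u, hu, rfl⟩
    obtain ⟨v, hv⟩ : ∃ v : K, (((⟨h, hh⟩ : H) : H ⧸ K).out : H) = ⟨h, hh⟩ * v :=
      QuotientGroup.mk_out_eq_mul K ⟨h, hh⟩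
    have hvG : ((((⟨h, hh⟩ : H) : H ⧸ K).out : H) : G) = h * ((v : H) : G) := by
      rw [hv]; rfl
    have hvc : ((v : H) : G) ∈ auxCore H x := Subgroup.mem_subgroupOf.1 v.2
    have hwc : x⁻¹ * ((v : H) : G)⁻¹ * x * u * ((v : H) : G) ∈ auxCore H x :=
      mul_mem (mul_mem (auxCore_conj H x _ (inv_mem hvc)) hu) hvc
    refine ⟨⟨((⟨h, hh⟩ : H) : H ⧸ K), ⟨⟨_, auxCore_le H x hwc⟩,
      Subgroup.mem_subgroupOf.2 hwc⟩⟩, ?_⟩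
    apply Subtype.ext
    change ((((⟨h, hh⟩ : H) : H ⧸ K).out : H) : G) *
      (x * (x⁻¹ * ((v : H) : G)⁻¹ * x * u * ((v : H) : G))) *
      ((((⟨h, hh⟩ : H) : H ⧸ K).out : H) : G)⁻¹ = h * (x * u) * h⁻¹
    rw [hvG]; group

/-- If `H` centralizes `y` and `|H|` divides `p ^ b`, then `|H|` divides the number of
`p ^ b`-th roots of `y`. -/
theorem aux_prime_pow {p : ℕ} [hp : Fact p.Prime] {G : Type*} [Group G] [Finite G] (b : ℕ)
    (y : G) (H : Subgroup G) (hH : ∀ h ∈ H, h * y = y * h) (hc : Nat.card H ∣ p ^ b) :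
    Nat.card H ∣ Nat.card {x : G // x ^ p ^ b = y} := by
  classical
  have hstab : ∀ x z : G, (auxSetoid H).r x z → x ^ p ^ b = y → z ^ p ^ b = y := by
    rintro x _ ⟨h, hh, u, hu, rfl⟩ hx
    rw [conj_pow, aux_pow b x (auxCore H x) (auxCore_conj H x)
      (by intro k hk; rw [hx]; exact (hH k (auxCore_le H x hk)).symm)
      ((Subgroup.card_dvd_of_le (auxCore_le H x)).trans hc) u hu, hx, hH h hh,
      mul_inv_cancel_right]
  let q : {x : G // x ^ p ^ b = y} → Quotient (auxSetoid H) := fun x => Quotient.mk _ x.1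
  have := Fintype.ofFinite (Quotient (auxSetoid H))
  rw [← Nat.card_congr (Equiv.sigmaFiberEquiv q), Nat.card_sigma]
  apply Finset.dvd_sum
  intro c _
  by_cases hne : Nonempty {a : {x : G // x ^ p ^ b = y} // q a = c}
  · obtain ⟨⟨⟨x, hx⟩, hxc⟩⟩ := hne
    rw [← auxClass_card H x]
    apply dvd_of_eq
    apply Nat.card_congr
    exact
      { toFun := fun z => ⟨⟨z.1, hstab x z.1 z.2 hx⟩, by
          rw [← hxc]; exact Quotient.sound ((auxSetoid H).symm z.2)⟩
        invFun := fun a => ⟨a.1.1, Quotient.exact (hxc.trans a.2.symm)⟩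
        left_inv := fun z => rfl
        right_inv := fun a => rfl }
  · rw [not_nonempty_iff] at hne
    simp

theorem aux_class_mul_centralizer {G : Type*} [Group G] [Finite G] (y : G) :
    Nat.card {z : G // ConjClasses.mk z = ConjClasses.mk y} *
      Nat.card (Subgroup.centralizer {y}) = Nat.card G := by
  have hconj : Nat.card {z : G // ConjClasses.mk z = ConjClasses.mk y} =
      Nat.card (MulAction.orbit (ConjAct G) y) := by
    rw [ConjAct.orbit_eq_carrier_conjClasses]
    exact Nat.card_congr (Equiv.subtypeEquivRight fun z =>
      ConjClasses.mem_carrier_iff_mk_eq.symm)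
  rw [hconj, Subgroup.nat_card_centralizer_nat_card_stabilizer, ← Nat.card_prod,
    Nat.card_congr (MulAction.orbitProdStabilizerEquivGroup (ConjAct G) y)]
  rfl

theorem stmt_12 (G : Type*) [Group G] [Fintype G] (g : G) (hg : g ∈ Subgroup.center G)
    (n : ℕ) (hn : 0 < n) :
    Nat.gcd n (Nat.card G) ∣ Nat.card {x : G // x ^ n = g} := by
  classical
  rw [Nat.dvd_iff_prime_pow_dvd_dvd]
  intro p k hp hpk
  have : Fact p.Prime := ⟨hp⟩
  obtain ⟨r, rfl⟩ := hpk.trans (Nat.gcd_dvd_left _ _)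
  have hG := hpk.trans (Nat.gcd_dvd_right _ _)
  have hroot : ∀ y : G, p ^ k ∣ Nat.card {z : G // ConjClasses.mk z = ConjClasses.mk y} *
      Nat.card {x : G // x ^ p ^ k = y} := by
    intro y
    obtain ⟨j, hj, hj2⟩ := (Nat.dvd_prime_pow hp).1
      (Nat.gcd_dvd_left (p ^ k) (Nat.card (Subgroup.centralizer {y})))
    obtain ⟨K, hK⟩ := Sylow.exists_subgroup_card_pow_prime (G := Subgroup.centralizer {y}) p
      (n := j) (hj2 ▸ Nat.gcd_dvd_right _ _)
    have hcard : Nat.card (K.map (Subgroup.centralizer {y}).subtype) = p ^ j := by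
      rw [Subgroup.card_map_of_injective (Subgroup.subtype_injective _), hK]
    have h1 := aux_prime_pow (p := p) k y (K.map (Subgroup.centralizer {y}).subtype) (by
      rintro _ ⟨h, _, rfl⟩
      exact (Subgroup.mem_centralizer_singleton_iff.1 h.2)) (by
      rw [hcard]; exact pow_dvd_pow p hj)
    rw [hcard, ← hj2] at h1
    refine dvd_trans ?_ (Nat.mul_dvd_mul_left _ h1)
    rw [← Nat.gcd_mul_left]
    apply Nat.dvd_gcd (Dvd.intro_left _ rfl)
    rw [aux_class_mul_centralizer]; exact hG
  let q : {x : G // x ^ (p ^ k * r) = g} → ConjClasses G := fun x => ConjClasses.mk (x.1 ^ p ^ k)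
  have := Fintype.ofFinite (ConjClasses G)
  rw [← Nat.card_congr (Equiv.sigmaFiberEquiv q), Nat.card_sigma]
  apply Finset.dvd_sum
  intro c _
  by_cases hne : Nonempty {a : {x : G // x ^ (p ^ k * r) = g} // q a = c}
  · obtain ⟨⟨⟨x, hx⟩, hxc⟩⟩ := hne
    set y := x ^ p ^ k with hy
    have hyr : y ^ r = g := by rw [hy, ← pow_mul, hx]
    have hconj : ∀ z : G, ConjClasses.mk z = ConjClasses.mk y → z ^ r = g := by
      intro z hz
      obtain ⟨w, hw⟩ := isConj_iff.1 (ConjClasses.mk_eq_mk_iff_isConj.1 hz.symm)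
      rw [← hw, conj_pow, hyr, Subgroup.mem_center_iff.1 hg w, mul_inv_cancel_right]
    have hsame : ∀ z : G, ConjClasses.mk z = ConjClasses.mk y →
        Nat.card {x : G // x ^ p ^ k = z} = Nat.card {x : G // x ^ p ^ k = y} := by
      intro z hz
      obtain ⟨w, hw⟩ := isConj_iff.1 (ConjClasses.mk_eq_mk_iff_isConj.1 hz)
      apply Nat.card_congr
      refine Equiv.subtypeEquiv (MulAut.conj w).toEquiv ?_
      intro a
      change a ^ p ^ k = z ↔ (w * a * w⁻¹) ^ p ^ k = y
      rw [conj_pow, ← hw]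
      simp
    have hcount : Nat.card {a : {x : G // x ^ (p ^ k * r) = g} // q a = c}
        = Nat.card {z : G // ConjClasses.mk z = ConjClasses.mk y} *
          Nat.card {x : G // x ^ p ^ k = y} := by
      have e : {a : {x : G // x ^ (p ^ k * r) = g} // q a = c} ≃
          Σ z : {z : G // ConjClasses.mk z = ConjClasses.mk y}, {x : G // x ^ p ^ k = z.1} :=
        { toFun := fun a => ⟨⟨a.1.1 ^ p ^ k, a.2.trans hxc.symm⟩, ⟨a.1.1, rfl⟩⟩
          invFun := fun s => ⟨⟨s.2.1, by rw [pow_mul, s.2.2]; exact hconj _ s.1.2⟩, by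
            rw [← hxc]
            change ConjClasses.mk (s.2.1 ^ p ^ k) = ConjClasses.mk y
            rw [s.2.2]; exact s.1.2⟩
          left_inv := fun a => rfl
          right_inv := by
            rintro ⟨⟨z, hz⟩, ⟨x', hx'⟩⟩
            change x' ^ p ^ k = z at hx'
            subst hx'
            rfl }
      rw [Nat.card_congr e, Nat.card_sigma, Finset.sum_congr rfl (fun z _ => hsame z.1 z.2)]
      simp [Nat.card_eq_fintype_card]
    rw [hcount]
    exact hroot y
  · rw [not_nonempty_iff] at hne
    simp
end
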